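/- Let f ∈ ℍ[t] be a special quaternionic polynomial, and let p ∈ ℝ[t] be a real polynomial such that f̄·f equals the image of p under the algebra map ℝ[t] → ℍ[t]; assume that every complex root of p lies on the imaginary axis (for every w ∈ ℂ with p(w) = 0 one has Re(w) = 0). Let α ∈ ℍ be a right root of f. Then: (1) Re(α) = 0; (2) if moreover α is an isolated root, i.e. α is the only right root of f in its similarity class, then α ∈ span_ℝ{𝐣, 𝐤}, i.e. both the real part and the 𝐢-component of α vanish. -/

import Mathlib

open Polynomial

/-- Right evaluation of a quaternionic polynomial `f` at `β`:
`evʳ_f(β) = Σ_k f_k β^k`, coefficients on the left. -/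
noncomputable def evalR (β : Quaternion ℝ) (f : Polynomial (Quaternion ℝ)) : Quaternion ℝ :=
  ∑ k ∈ Finset.range (f.natDegree + 1), f.coeff k * β ^ k

/-- The similarity class of a quaternion `α`: all `γ α γ⁻¹` with `γ ≠ 0`. -/
def simClass (α : Quaternion ℝ) : Set (Quaternion ℝ) :=
  {β | ∃ γ : Quaternion ℝ, γ ≠ 0 ∧ β = γ * α * γ⁻¹}

/-- A quaternionic polynomial is *special* if all its even-degree coefficients lie in
`span_ℝ{1, 𝐢}` and all its odd-degree coefficients lie in `span_ℝ{𝐣, 𝐤}`. -/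
def IsSpecial (f : Polynomial (Quaternion ℝ)) : Prop :=
  ∀ k : ℕ, (Even k → (f.coeff k).imJ = 0 ∧ (f.coeff k).imK = 0) ∧
    (Odd k → (f.coeff k).re = 0 ∧ (f.coeff k).imI = 0)

/-- The conjugate polynomial `f̄`, obtained by applying quaternionic conjugation
to each coefficient of `f`. -/
noncomputable def pconj (f : Polynomial (Quaternion ℝ)) : Polynomial (Quaternion ℝ) :=
  ∑ k ∈ Finset.range (f.natDegree + 1), Polynomial.C (star (f.coeff k)) * Polynomial.X ^ k

/-- Quaternion from components. -/
def mkQ (a b c d : ℝ) : Quaternion ℝ := ⟨a, b, c, d⟩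

@[simp] lemma mkQ_re (a b c d : ℝ) : (mkQ a b c d).re = a := rfl
@[simp] lemma mkQ_imI (a b c d : ℝ) : (mkQ a b c d).imI = b := rfl
@[simp] lemma mkQ_imJ (a b c d : ℝ) : (mkQ a b c d).imJ = c := rfl
@[simp] lemma mkQ_imK (a b c d : ℝ) : (mkQ a b c d).imK = d := rfl
@[simp] lemma q_zero_imJ : (0 : Quaternion ℝ).imJ = 0 := rfl
@[simp] lemma q_zero_imK : (0 : Quaternion ℝ).imK = 0 := rfl
@[simp] lemma q_one_re : (1 : Quaternion ℝ).re = 1 := rfl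
@[simp] lemma q_one_imI : (1 : Quaternion ℝ).imI = 0 := rfl
@[simp] lemma q_one_imJ : (1 : Quaternion ℝ).imJ = 0 := rfl
@[simp] lemma q_one_imK : (1 : Quaternion ℝ).imK = 0 := rfl

lemma evalR_eq_eval (β : Quaternion ℝ) (f : Polynomial (Quaternion ℝ)) :
    evalR β f = f.eval β := by
  rw [evalR, Polynomial.eval_eq_sum_range]

lemma eval_mul_zero (g f : Polynomial (Quaternion ℝ)) (α : Quaternion ℝ)
    (h : f.eval α = 0) : (g * f).eval α = 0 := by
  induction g using Polynomial.induction_on' with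
  | add p q hp hq => rw [add_mul, eval_add, hp, hq, add_zero]
  | monomial n a =>
    rw [← C_mul_X_pow_eq_monomial, mul_assoc, eval_C_mul, (commute_X_pow f n).eq,
      eval_mul_X_pow, h, zero_mul, mul_zero]

lemma exists_unit_im (α : Quaternion ℝ) : ∃ (u : Quaternion ℝ) (y : ℝ), u * u = -1 ∧
    α = (α.re : Quaternion ℝ) + y • u := by
  by_cases h : α.im = 0
  · refine ⟨(mkQ (0) (1) (0) (0)), 0, ?_, ?_⟩
    · ext <;> simp
    · rw [zero_smul, add_zero]
      conv_lhs => rw [← Quaternion.re_add_im α, h, add_zero]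
  · have hn : ‖α.im‖ ≠ 0 := norm_ne_zero_iff.mpr h
    refine ⟨‖α.im‖⁻¹ • α.im, ‖α.im‖, ?_, ?_⟩
    · have h2 : α.im * α.im = -((‖α.im‖ ^ 2 : ℝ) : Quaternion ℝ) := by
        have h3 := Quaternion.im_sq α.im
        rw [Quaternion.im_idem, Quaternion.normSq_eq_norm_mul_self, ← sq] at h3
        rw [← sq, h3]
      rw [smul_mul_smul_comm, h2, smul_neg, Quaternion.smul_coe]
      rw [show ‖α.im‖⁻¹ * ‖α.im‖⁻¹ * ‖α.im‖ ^ 2 = 1 by field_simp]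
      simp
    · rw [smul_smul, mul_inv_cancel₀ hn, one_smul, Quaternion.re_add_im]

theorem special_root_purely_imaginary
    (f : Polynomial (Quaternion ℝ)) (hsp : IsSpecial f)
    (p : Polynomial ℝ) (hp : pconj f * f = p.map (algebraMap ℝ (Quaternion ℝ)))
    (hroots : ∀ w : ℂ, Polynomial.aeval w p = 0 → w.re = 0)
    (α : Quaternion ℝ) (hα : evalR α f = 0) :
    α.re = 0 ∧
    ((∀ β ∈ simClass α, evalR β f = 0 → β = α) → α.re = 0 ∧ α.imI = 0) := by
  have hre : α.re = 0 := by
    have h1 : aeval α p = 0 := by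
      rw [← eval_map_algebraMap, ← hp]
      exact eval_mul_zero _ _ _ (by rw [← evalR_eq_eval, hα])
    obtain ⟨u, y, hu, hy⟩ := exists_unit_im α
    have h2 : Complex.lift ⟨u, hu⟩ ⟨α.re, y⟩ = α := by
      conv_rhs => rw [hy]
      simp [Complex.liftAux_apply, Quaternion.algebraMap_def]
    rw [← h2, aeval_algHom_apply] at h1
    exact hroots _ ((map_eq_zero_iff _ (Complex.lift ⟨u, hu⟩).toRingHom.injective).mp h1)
  refine ⟨hre, fun hiso => ⟨hre, ?_⟩⟩
  set i : Quaternion ℝ := (mkQ (0) (1) (0) (0)) with hi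
  have hii : i * i = -1 := by ext <;> simp [hi]
  have hβ : i * α * i = (mkQ (0) (-α.imI) (α.imJ) (α.imK)) := by
    ext <;> simp [hi, hre]
  have hpow : ∀ k : ℕ, (i * α * i) ^ k * i = (-1) ^ k * (i * α ^ k) := by
    intro k
    induction k with
    | zero => simp
    | succ k ih =>
      have : i * α * i * i = -(i * α) := by rw [mul_assoc, hii]; simp
      rw [pow_succ, mul_assoc, this, mul_neg, ← mul_assoc, ih, pow_succ, pow_succ]
      simp [mul_assoc]
  have hcoef : ∀ k : ℕ, f.coeff k * ((-1) ^ k * i) = i * f.coeff k := by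
    intro k
    rcases Nat.even_or_odd k with hk | hk
    · obtain ⟨h1, h2⟩ := (hsp k).1 hk
      rw [hk.neg_one_pow, one_mul]
      ext <;> simp [hi, h1, h2]
    · obtain ⟨h1, h2⟩ := (hsp k).2 hk
      rw [hk.neg_one_pow]
      ext <;> simp [hi, h1, h2]
  have hroot : evalR (i * α * i) f = 0 := by
    have h0 : evalR (i * α * i) f * i = i * evalR α f := by
      rw [evalR, evalR, Finset.sum_mul, Finset.mul_sum]
      refine Finset.sum_congr rfl fun k _ => ?_
      rw [mul_assoc, hpow, ← mul_assoc i, ← hcoef]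
      simp only [mul_assoc]
    rw [hα, mul_zero] at h0
    rcases mul_eq_zero.mp h0 with h | h
    · exact h
    · rw [h] at hii; simp at hii
  have hsim : i * α * i ∈ simClass α := by
    by_cases hv : α.imJ = 0 ∧ α.imK = 0
    · have hj : (mkQ (0) (0) (1) (0)) ≠ 0 := fun h => by
        have := congrArg QuaternionAlgebra.imJ h
        simp at this
      refine ⟨(mkQ (0) (0) (1) (0)), hj, ?_⟩
      rw [eq_mul_inv_iff_mul_eq₀ hj, hβ]
      ext <;> simp [hre, hv.1, hv.2]
    · have hj : (mkQ (0) (0) (α.imJ) (α.imK)) ≠ 0 := fun h => hv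
        ⟨by simpa using congrArg QuaternionAlgebra.imJ h,
          by simpa using congrArg QuaternionAlgebra.imK h⟩
      refine ⟨_, hj, ?_⟩
      rw [eq_mul_inv_iff_mul_eq₀ hj, hβ]
      ext <;> simp [hre] <;> ring
  have h := congrArg QuaternionAlgebra.imI (hiso _ hsim hroot)
  rw [hβ] at h
  simp only [mkQ_imI] at h
  linarith
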